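/- The signal-noise decomposition coefficients satisfy γ_{j,r}^{(0)} = ζ_{j,r,i}^{(0)} = ω_{j,r,i}^{(0)} = 0 and, for all r ∈ [m], j ∈ {±1}, i ∈ [n] and t ≥ 0, the iterative equations: γ_{j,r}^{(t+1)} = γ_{j,r}^{(t)} − (η/(nm))·[Σ_{i∈S₊} ℓ_i'^{(t)} σ'(⟨w_{j,r}^{(t)}, ŷ_i·μ⟩) − Σ_{i∈S₋} ℓ_i'^{(t)} σ'(⟨w_{j,r}^{(t)}, ŷ_i·μ⟩)]·‖μ‖₂²; ζ_{j,r,i}^{(t+1)} = ζ_{j,r,i}^{(t)} − (η/(nm))·ℓ_i'^{(t)}·σ'(⟨w_{j,r}^{(t)}, ξ_i⟩)·‖ξ_i‖₂²·1(y_i = j); ω_{j,r,i}^{(t+1)} = ω_{j,r,i}^{(t)} + (η/(nm))·ℓ_i'^{(t)}·σ'(⟨w_{j,r}^{(t)}, ξ_i⟩)·‖ξ_i‖₂²·1(y_i = −j), where S₊ = {i ∈ [n] : y_i = ŷ_i} and S₋ = {i ∈ [n] : y_i ≠ ŷ_i}. -/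

import Mathlib

open MeasureTheory ProbabilityTheory Real Finset
open scoped ENNReal

noncomputable section

/-- Euclidean inner product on `Fin d → ℝ`. -/
def dotp {d : ℕ} (v w : Fin d → ℝ) : ℝ := ∑ k, v k * w k

/-- Squared Euclidean norm. -/
def nsq {d : ℕ} (v : Fin d → ℝ) : ℝ := ∑ k, (v k) ^ 2

/-- Euclidean norm. -/
def nrm {d : ℕ} (v : Fin d → ℝ) : ℝ := Real.sqrt (nsq v)

/-- ReLU activation. -/
def relu (z : ℝ) : ℝ := max z 0

/-- Derivative convention for ReLU: `σ'(z) = 1` if `z ≥ 0`, else `0`. -/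
def drelu (z : ℝ) : ℝ := if 0 ≤ z then (1 : ℝ) else 0

/-- Logistic loss `ℓ(z) = log(1 + exp (−z))`. -/
def logloss (z : ℝ) : ℝ := Real.log (1 + Real.exp (-z))

/-- Derivative of the logistic loss: `ℓ'(z) = −1/(1 + exp z)`. -/
def dlogloss (z : ℝ) : ℝ := -(1 / (1 + Real.exp z))

/-- Real value (±1) of a Boolean sign index. -/
def jval (j : Bool) : ℝ := if j then 1 else -1

/-- Boolean sign index of a real (±1) label. -/
def bsign (x : ℝ) : Bool := decide (0 < x)

/-- Two-layer ReLU CNN `f(W, x) = F₊₁(W₊₁,x) − F₋₁(W₋₁,x)` on two patches `x1, x2`. -/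
def fnn {d : ℕ} (m : ℕ) (W : Bool → Fin m → Fin d → ℝ) (x1 x2 : Fin d → ℝ) : ℝ :=
  (m : ℝ)⁻¹ * ∑ r, (relu (dotp (W true r) x1) + relu (dotp (W true r) x2))
    - (m : ℝ)⁻¹ * ∑ r, (relu (dotp (W false r) x1) + relu (dotp (W false r) x2))

/-- Empirical logistic loss `L_S(W)` of the CNN on the training sample with
signal patches `ŷᵢ • μ` and noise patches `ξᵢ`. -/
def empLoss {d : ℕ} (n m : ℕ) (μv : Fin d → ℝ) (yhat y : Fin n → ℝ)
    (ξ : Fin n → Fin d → ℝ) (W : Bool → Fin m → Fin d → ℝ) : ℝ :=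
  (n : ℝ)⁻¹ * ∑ i, logloss (y i * fnn m W (yhat i • μv) (ξ i))

/-- One step of gradient descent (with the convention `σ'(z) = 1(z ≥ 0)`), for every `t`. -/
def GDupdate {d : ℕ} (n m : ℕ) (μv : Fin d → ℝ) (η : ℝ) (yhat y : Fin n → ℝ)
    (ξ : Fin n → Fin d → ℝ) (W : ℕ → Bool → Fin m → Fin d → ℝ) : Prop :=
  ∀ t j r, W (t + 1) j r = W t j r
    - (η / ((n : ℝ) * m)) • (∑ i, (dlogloss (y i * fnn m (W t) (yhat i • μv) (ξ i))
        * drelu (dotp (W t j r) (ξ i)) * jval j * y i) • ξ i)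
    - (η / ((n : ℝ) * m)) • (∑ i, (dlogloss (y i * fnn m (W t) (yhat i • μv) (ξ i))
        * drelu (yhat i * dotp (W t j r) μv) * yhat i * y i * jval j) • μv)

theorem coef_unique {d n : ℕ} (μv : Fin d → ℝ) (ξ : Fin n → Fin d → ℝ)
    (hind : LinearIndependent ℝ (Fin.cons μv ξ : Fin (n + 1) → Fin d → ℝ))
    (a : ℝ) (b : Fin n → ℝ) (h : a • μv + ∑ i, b i • ξ i = 0) : a = 0 ∧ ∀ i, b i = 0 := by
  have h1 := Fintype.linearIndependent_iff.mp hind (Fin.cons a b)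
    (by rw [Fin.sum_univ_succ]; simpa using h)
  exact ⟨by simpa using h1 0, fun i => by simpa using h1 i.succ⟩

theorem nrm_sq_pos {d : ℕ} (v : Fin d → ℝ) (hv : v ≠ 0) : 0 < nrm v ^ 2 := by
  have h0 : 0 ≤ nsq v := Finset.sum_nonneg (fun k _ => sq_nonneg _)
  rw [nrm, Real.sq_sqrt h0]
  refine lt_of_le_of_ne h0 (fun h => hv ?_)
  funext k
  have := (Finset.sum_eq_zero_iff_of_nonneg (fun k _ => sq_nonneg (v k))).mp h.symm k
    (Finset.mem_univ k)
  simpa using this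

theorem jval_sq (j : Bool) : jval j * jval j = 1 := by
  cases j <;> simp [jval]

theorem dlogloss_neg (z : ℝ) : dlogloss z ≤ 0 := by
  have := Real.exp_pos z
  unfold dlogloss
  have : 0 ≤ 1 / (1 + Real.exp z) := by positivity
  linarith

theorem drelu_nonneg (z : ℝ) : 0 ≤ drelu z := by
  unfold drelu
  split_ifs <;> norm_num

/-- Lemma 5.2: the signal-noise decomposition coefficients start at `0`
and satisfy the stated iterative equations, where `ζ = max(ρ, 0)` and `ω = min(ρ, 0)`,
`S₊ = {i : yᵢ = ŷᵢ}` and `S₋ = {i : yᵢ ≠ ŷᵢ}`. -/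
theorem coefficient_iteration {d : ℕ} (n m : ℕ) (μv : Fin d → ℝ) (η : ℝ)
    (yhat y : Fin n → ℝ) (ξ : Fin n → Fin d → ℝ)
    (W : ℕ → Bool → Fin m → Fin d → ℝ)
    (γ : ℕ → Bool → Fin m → ℝ) (ρ : ℕ → Bool → Fin m → Fin n → ℝ)
    (hn : 0 < n) (hm : 0 < m) (hη : 0 < η)
    (hyhat : ∀ i, yhat i = 1 ∨ yhat i = -1) (hy : ∀ i, y i = 1 ∨ y i = -1)
    (hind : LinearIndependent ℝ (Fin.cons μv ξ : Fin (n + 1) → Fin d → ℝ))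
    (hGD : GDupdate n m μv η yhat y ξ W)
    (hdecomp : ∀ t j r, W t j r = W 0 j r
      + (jval j * γ t j r * (nrm μv ^ 2)⁻¹) • μv
      + ∑ i, (ρ t j r i * (nrm (ξ i) ^ 2)⁻¹) • ξ i) :
    (∀ j r, γ 0 j r = 0)
    ∧ (∀ j r i, max (ρ 0 j r i) 0 = 0 ∧ min (ρ 0 j r i) 0 = 0)
    ∧ (∀ t j r,
        γ (t + 1) j r = γ t j r - (η / ((n : ℝ) * m)) *
          ((∑ i ∈ Finset.univ.filter (fun i => y i = yhat i),
              dlogloss (y i * fnn m (W t) (yhat i • μv) (ξ i))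
                * drelu (yhat i * dotp (W t j r) μv))
            - (∑ i ∈ Finset.univ.filter (fun i => y i ≠ yhat i),
              dlogloss (y i * fnn m (W t) (yhat i • μv) (ξ i))
                * drelu (yhat i * dotp (W t j r) μv))) * nrm μv ^ 2)
    ∧ (∀ t j r i,
        max (ρ (t + 1) j r i) 0 = max (ρ t j r i) 0 - (η / ((n : ℝ) * m)) *
          dlogloss (y i * fnn m (W t) (yhat i • μv) (ξ i))
          * drelu (dotp (W t j r) (ξ i)) * nrm (ξ i) ^ 2
          * (if y i = jval j then 1 else 0))
    ∧ (∀ t j r i,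
        min (ρ (t + 1) j r i) 0 = min (ρ t j r i) 0 + (η / ((n : ℝ) * m)) *
          dlogloss (y i * fnn m (W t) (yhat i • μv) (ξ i))
          * drelu (dotp (W t j r) (ξ i)) * nrm (ξ i) ^ 2
          * (if y i = -jval j then 1 else 0)) := by
  have hμ : 0 < nrm μv ^ 2 := nrm_sq_pos _ (by simpa using hind.ne_zero 0)
  have hξ : ∀ i, 0 < nrm (ξ i) ^ 2 := fun i =>
    nrm_sq_pos _ (by simpa using hind.ne_zero i.succ)
  have hj0 : ∀ j, jval j ≠ 0 := fun j => by cases j <;> simp [jval]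
  have h0 : ∀ j r, γ 0 j r = 0 ∧ ∀ i, ρ 0 j r i = 0 := by
    intro j r
    obtain ⟨h1, h2⟩ := coef_unique μv ξ hind (jval j * γ 0 j r * (nrm μv ^ 2)⁻¹)
      (fun i => ρ 0 j r i * (nrm (ξ i) ^ 2)⁻¹) (by
        have h := hdecomp 0 j r
        rw [add_assoc] at h
        exact left_eq_add.mp h)
    refine ⟨?_, fun i => ?_⟩
    · have := inv_ne_zero hμ.ne'
      simpa [hj0 j, hμ.ne', -inv_eq_zero, this] using h1
    · have := inv_ne_zero (hξ i).ne'
      rcases mul_eq_zero.mp (h2 i) with h | h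
      · exact h
      · exact absurd h this
  set c := η / ((n : ℝ) * m) with hc
  have hcpos : 0 < c := by positivity
  set L : ℕ → Fin n → ℝ := fun t i => dlogloss (y i * fnn m (W t) (yhat i • μv) (ξ i)) with hL
  have hstep : ∀ t j r,
      (γ (t + 1) j r = γ t j r - c * (∑ i, L t i * drelu (yhat i * dotp (W t j r) μv)
          * yhat i * y i) * nrm μv ^ 2)
      ∧ ∀ i, ρ (t + 1) j r i = ρ t j r i
          - c * L t i * drelu (dotp (W t j r) (ξ i)) * nrm (ξ i) ^ 2 * (jval j * y i) := by
    intro t j r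
    have hg := hGD t j r
    rw [hdecomp (t + 1) j r] at hg
    have hd := hdecomp t j r
    rw [← Finset.sum_smul, ← hc] at hg
    obtain ⟨h1, h2⟩ := coef_unique μv ξ hind
      (jval j * γ (t + 1) j r * (nrm μv ^ 2)⁻¹ - jval j * γ t j r * (nrm μv ^ 2)⁻¹
        + c * ∑ i, L t i * drelu (yhat i * dotp (W t j r) μv) * yhat i * y i * jval j)
      (fun i => ρ (t + 1) j r i * (nrm (ξ i) ^ 2)⁻¹ - ρ t j r i * (nrm (ξ i) ^ 2)⁻¹
        + c * (L t i * drelu (dotp (W t j r) (ξ i)) * jval j * y i)) (by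
        simp only [add_smul, sub_smul, Finset.sum_add_distrib, Finset.sum_sub_distrib,
          mul_smul c, ← Finset.smul_sum]
        simp only [hL]
        linear_combination (norm := skip) hg + hd
        abel)
    refine ⟨?_, fun i => ?_⟩
    · rw [← Finset.sum_mul] at h1
      have hinv := inv_mul_cancel₀ hμ.ne'
      have h4 := (mul_eq_zero.mp (show jval j * (γ (t + 1) j r - γ t j r
        + c * (∑ i, L t i * drelu (yhat i * dotp (W t j r) μv) * yhat i * y i)
          * nrm μv ^ 2) = 0 by
          linear_combination nrm μv ^ 2 * h1
            - (jval j * γ (t + 1) j r - jval j * γ t j r) * hinv)).resolve_left (hj0 j)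
      linear_combination h4
    · have h3 := h2 i
      have hinv := inv_mul_cancel₀ (hξ i).ne'
      linear_combination nrm (ξ i) ^ 2 * h3 - (ρ (t + 1) j r i - ρ t j r i) * hinv
  have hyj : ∀ i j, (y i = jval j ∧ y i ≠ -jval j ∧ jval j * y i = 1)
      ∨ (y i ≠ jval j ∧ y i = -jval j ∧ jval j * y i = -1) := by
    intro i j
    rcases hy i with h | h <;> cases j <;> rw [h] <;> norm_num [jval]
  have hD : ∀ t j r i,
      c * L t i * drelu (dotp (W t j r) (ξ i)) * nrm (ξ i) ^ 2 ≤ 0 := by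
    intro t j r i
    have h1 : L t i ≤ 0 := dlogloss_neg _
    exact mul_nonpos_of_nonpos_of_nonneg (mul_nonpos_of_nonpos_of_nonneg
      (mul_nonpos_of_nonneg_of_nonpos hcpos.le h1) (drelu_nonneg _)) (hξ i).le
  have hsgn : ∀ t j r i, (y i = jval j → 0 ≤ ρ t j r i) ∧ (y i = -jval j → ρ t j r i ≤ 0) := by
    intro t j r i
    induction t with
    | zero => simp [(h0 j r).2 i]
    | succ t ih =>
      rw [(hstep t j r).2 i]
      have h1 := hD t j r i
      rcases hyj i j with ⟨ha, hb, he⟩ | ⟨ha, hb, he⟩ <;> rw [he]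
      · exact ⟨fun _ => by linarith [ih.1 ha], fun h => absurd h hb⟩
      · exact ⟨fun h => absurd h ha, fun _ => by linarith [ih.2 hb]⟩
  refine ⟨fun j r => (h0 j r).1, fun j r i => by simp [(h0 j r).2 i], ?_, ?_, ?_⟩
  · intro t j r
    rw [(hstep t j r).1]
    congr 3
    rw [Finset.sum_filter, Finset.sum_filter, ← Finset.sum_sub_distrib]
    refine Finset.sum_congr rfl (fun i _ => ?_)
    rcases hy i with h | h <;> rcases hyhat i with h' | h' <;> simp only [hL, h, h'] <;> norm_num
  · intro t j r i
    have h1 := hsgn t j r i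
    have h2 := hsgn (t + 1) j r i
    have h3 := (hstep t j r).2 i
    rcases hyj i j with ⟨ha, hb, he⟩ | ⟨ha, hb, he⟩
    · rw [max_eq_left (h1.1 ha), max_eq_left (h2.1 ha), h3, he, if_pos ha]
    · rw [max_eq_right (h1.2 hb), max_eq_right (h2.2 hb), if_neg ha]
      ring
  · intro t j r i
    have h1 := hsgn t j r i
    have h2 := hsgn (t + 1) j r i
    have h3 := (hstep t j r).2 i
    rcases hyj i j with ⟨ha, hb, he⟩ | ⟨ha, hb, he⟩
    · rw [min_eq_right (h1.1 ha), min_eq_right (h2.1 ha), if_neg hb]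
      ring
    · rw [min_eq_left (h1.2 hb), min_eq_left (h2.2 hb), h3, he, if_pos hb]
      ring
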